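/- Let N≥2, 1<q≤1*=N/(N−1), M>0 and Ω_0=(0,1)^N. There exists a constant C=C(N,q,M) such that for every u∈BV(Ω_0) with |u|≤M almost everywhere, ‖u‖_{L^{1*,q}(Ω_0)}^q ≤ C (‖Du‖_{Ω_0} + ‖u‖_{L^1(Ω_0)}) (∫_{Ω_0} |u| dx)^{(q−1)/3}. -/

import Mathlib

open MeasureTheory Set Filter Topology ENNReal

noncomputable section

abbrev Euc (N : ℕ) := EuclideanSpace ℝ (Fin N)

/-- Decreasing rearrangement of `u` with respect to Lebesgue measure on `ℝ^N`. -/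
def rearr (N : ℕ) (u : Euc N → ℝ) (t : ℝ) : ℝ :=
  sInf {l : ℝ | 0 < l ∧ volume {x : Euc N | l < |u x|} ≤ ENNReal.ofReal t}

/-- Lorentz quasinorm `‖u‖_{L^{p,q}}` on `ℝ^N` (with `q = ∞` allowed). -/
def lorentz (N : ℕ) (p : ℝ) (q : ℝ≥0∞) (u : Euc N → ℝ) : ℝ≥0∞ :=
  if q = ∞ then ⨆ t ∈ Ioi (0:ℝ), ENNReal.ofReal (t ^ (1/p) * rearr N u t)
  else (∫⁻ t in Ioi (0:ℝ),
      ENNReal.ofReal ((t ^ (1/p) * rearr N u t) ^ q.toReal / t)) ^ (1 / q.toReal)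

/-- Divergence of a vector field on `ℝ^N`. -/
def divg (N : ℕ) (v : Euc N → Euc N) (x : Euc N) : ℝ :=
  ∑ i : Fin N, fderiv ℝ v x (EuclideanSpace.single i 1) i

/-- Total variation `‖Du‖_Ω` of `u` over a set `Ω`. -/
def TV (N : ℕ) (u : Euc N → ℝ) (Ω : Set (Euc N)) : ℝ≥0∞ :=
  ⨆ (v : Euc N → Euc N) (_ : ContDiff ℝ (⊤ : ℕ∞) v) (_ : HasCompactSupport v)
    (_ : ∀ x, ‖v x‖ ≤ 1) (_ : tsupport v ⊆ Ω),
    ENNReal.ofReal (∫ x, u x * divg N v x)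

/-- `u` vanishes at infinity. -/
def VanishAtInfinity (N : ℕ) (u : Euc N → ℝ) : Prop :=
  ∀ M : ℝ, 0 < M → volume {x : Euc N | M < |u x|} < ∞

/-- Membership in `BV̇(ℝ^N)`. -/
def MemBVdot (N : ℕ) (u : Euc N → ℝ) : Prop :=
  Measurable u ∧ VanishAtInfinity N u ∧ TV N u univ < ∞

/-- The rescaling `g[j,y]u = 2^{(N-1)j} u (2^j (· - y))`. -/
def resc (N : ℕ) (j : ℤ) (y : Euc N) (u : Euc N → ℝ) : Euc N → ℝ :=
  fun x => (2:ℝ) ^ (((N:ℤ) - 1) * j) * u ((2:ℝ) ^ j • (x - y))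

/-- Weak convergence `u k ⇀ w` in `BV̇(ℝ^N)`. -/
def WeakBVconv (N : ℕ) (u : ℕ → Euc N → ℝ) (w : Euc N → ℝ) : Prop :=
  (∀ K : Set (Euc N), IsCompact K →
      Tendsto (fun k => ∫ x in K, |u k x - w x|) atTop (𝓝 0)) ∧
  ∀ i : Fin N, ∀ f : Euc N → ℝ, ContDiff ℝ (⊤ : ℕ∞) f → HasCompactSupport f →
      Tendsto (fun k => ∫ x, u k x * fderiv ℝ f x (EuclideanSpace.single i 1)) atTop
        (𝓝 (∫ x, w x * fderiv ℝ f x (EuclideanSpace.single i 1)))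

/-- The open unit cube `(0,1)^N`. -/
def unitCube (N : ℕ) : Set (Euc N) := {x : Euc N | ∀ i : Fin N, x i ∈ Ioo (0:ℝ) 1}

open scoped Convolution
open ContinuousLinearMap (lsmul)

lemma rearr_nonneg (N : ℕ) (u : Euc N → ℝ) (t : ℝ) : 0 ≤ rearr N u t :=
  Real.sInf_nonneg fun _ h => h.1.le

lemma rearr_le {N : ℕ} {u : Euc N → ℝ} {t A : ℝ} (hA : 0 ≤ A)
    (h : ∀ l, A < l → volume {x : Euc N | l < |u x|} ≤ ENNReal.ofReal t) :
    rearr N u t ≤ A :=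
  le_of_forall_gt_imp_ge_of_dense fun l hl =>
    csInf_le ⟨0, fun _ h => h.1.le⟩ ⟨hA.trans_lt hl, h l hl⟩

lemma rearr_le_of_ae_le {N : ℕ} {u : Euc N → ℝ} {M : ℝ} (hM : 0 ≤ M)
    (h : ∀ᵐ x, |u x| ≤ M) (t : ℝ) : rearr N u t ≤ M := by
  refine rearr_le hM fun l hl => ?_
  have : volume {x : Euc N | l < |u x|} = 0 := by
    refine measure_mono_null (fun x hx => ?_) (ae_iff.1 h)
    simpa using hl.trans hx
  simp [this]

lemma rearr_le_of_eLpNorm_le {N : ℕ} {u : Euc N → ℝ} (hu : AEStronglyMeasurable u volume)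
    {p K : ℝ} (hp : 0 < p) (hK : 0 ≤ K)
    (h : eLpNorm u (ENNReal.ofReal p) volume ≤ ENNReal.ofReal K) {t : ℝ} (ht : 0 < t) :
    rearr N u t ≤ K * t ^ (-(1 / p)) := by
  refine rearr_le (by positivity) fun l hl => ?_
  have hl0 : 0 < l := lt_of_le_of_lt (by positivity) hl
  have h1 : volume {x : Euc N | l < |u x|} ≤ volume {x | ENNReal.ofReal l ≤ ‖u x‖ₑ} := by
    refine measure_mono fun x hx => ?_
    simp only [mem_ofPred_eq] at hx ⊢
    rw [← ofReal_norm, Real.norm_eq_abs]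
    exact ENNReal.ofReal_le_ofReal hx.le
  have h2 := meas_ge_le_mul_pow_eLpNorm_enorm volume (p := ENNReal.ofReal p)
    (by simpa using hp) (by simp) hu (ε := ENNReal.ofReal l) (by simpa using hl0) (by simp)
  rw [ENNReal.toReal_ofReal hp.le] at h2
  refine h1.trans (h2.trans ?_)
  calc (ENNReal.ofReal l)⁻¹ ^ p * eLpNorm u (ENNReal.ofReal p) volume ^ p
      ≤ (ENNReal.ofReal l)⁻¹ ^ p * ENNReal.ofReal K ^ p := by gcongr
    _ = ENNReal.ofReal ((l⁻¹ * K) ^ p) := by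
        rw [← ENNReal.mul_rpow_of_nonneg _ _ hp.le, ← ENNReal.ofReal_inv_of_pos hl0,
          ← ENNReal.ofReal_mul (by positivity), ENNReal.ofReal_rpow_of_nonneg (by positivity) hp.le]
    _ ≤ ENNReal.ofReal t := by
        refine ENNReal.ofReal_le_ofReal ?_
        have h3 : l⁻¹ * K ≤ t ^ (1 / p) := by
          rw [inv_mul_le_iff₀ hl0]
          rw [Real.rpow_neg ht.le, ← div_eq_mul_inv, div_lt_iff₀ (by positivity)] at hl
          exact hl.le
        calc (l⁻¹ * K) ^ p ≤ (t ^ (1 / p)) ^ p := by gcongr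
          _ = t := by rw [← Real.rpow_mul ht.le, one_div_mul_cancel hp.ne', Real.rpow_one]

lemma rearr_eq_zero_of_volume_support_le {N : ℕ} {u : Euc N → ℝ} {t : ℝ}
    (h : volume (Function.support u) ≤ ENNReal.ofReal t) : rearr N u t = 0 := by
  refine le_antisymm (rearr_le le_rfl fun l hl => (measure_mono fun x hx => ?_).trans h)
    (rearr_nonneg N u t)
  simpa using (hl.trans hx : 0 < |u x|)

lemma lorentz_integrand_le {p q M A m t r : ℝ} (hq : 1 < q) (ht : 0 < t)
    (hr : 0 ≤ r) (hM : 0 ≤ M) (hA : 0 ≤ A) (hm : 0 ≤ m) (h1 : r ≤ A * t ^ (-(1 / p))) (h2 : r ≤ M)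
    (h3 : r ≤ m * t ^ (-(1 : ℝ))) :
    (t ^ (1 / p) * r) ^ q / t
      ≤ A * M ^ (2 * (q - 1) / 3) * m ^ ((q - 1) / 3) * t ^ ((1 / p - 1 / 3) * (q - 1) - 1) := by
  have hq0 : 0 < q - 1 := by linarith
  have e1 : t ^ (1 / p) * r ≤ A := by
    rw [Real.rpow_neg ht.le, ← div_eq_mul_inv, le_div_iff₀ (by positivity)] at h1
    linarith
  have e2 : r ^ (q - 1) ≤ M ^ (2 * (q - 1) / 3) * (m * t ^ (-(1 : ℝ))) ^ ((q - 1) / 3) := by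
    calc r ^ (q - 1) = r ^ (2 * (q - 1) / 3 + (q - 1) / 3) := by ring_nf
      _ = r ^ (2 * (q - 1) / 3) * r ^ ((q - 1) / 3) :=
          Real.rpow_add_of_nonneg hr (by positivity) (by positivity)
      _ ≤ _ := by gcongr
  calc (t ^ (1 / p) * r) ^ q / t
      = (t ^ (1 / p) * r) * (t ^ (1 / p) * r) ^ (q - 1) / t := by
        rw [← Real.rpow_one_add' (by positivity) (by linarith)]; ring_nf
    _ ≤ A * (t ^ (1 / p) * r) ^ (q - 1) / t := by gcongr
    _ = A * ((t ^ (1 / p)) ^ (q - 1) * r ^ (q - 1)) / t := by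
        rw [Real.mul_rpow (by positivity) hr]
    _ ≤ A * ((t ^ (1 / p)) ^ (q - 1) *
          (M ^ (2 * (q - 1) / 3) * (m * t ^ (-(1 : ℝ))) ^ ((q - 1) / 3))) / t := by gcongr
    _ = _ := by
        rw [Real.mul_rpow hm (by positivity), ← Real.rpow_mul ht.le, ← Real.rpow_mul ht.le]
        have : t ^ ((1 / p - 1 / 3) * (q - 1) - 1)
            = t ^ (1 / p * (q - 1)) * t ^ (-1 * ((q - 1) / 3)) / t := by
          rw [← Real.rpow_add ht, ← Real.rpow_sub_one ht.ne']
          ring_nf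
        rw [this]; ring

lemma lorentz_rpow_le {N : ℕ} {u : Euc N → ℝ} (hu : AEStronglyMeasurable u volume)
    {p q M A m : ℝ} (hp : 0 < p) (hp3 : p < 3) (hq : 1 < q) (hM : 0 ≤ M) (hA : 0 ≤ A) (hm : 0 ≤ m)
    (hsupp : volume (Function.support u) ≤ 1) (huM : ∀ᵐ x, |u x| ≤ M)
    (hup : eLpNorm u (ENNReal.ofReal p) volume ≤ ENNReal.ofReal A)
    (hu1 : eLpNorm u 1 volume ≤ ENNReal.ofReal m) :
    lorentz N p (ENNReal.ofReal q) u ^ q ≤ ENNReal.ofReal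
      (A * M ^ (2 * (q - 1) / 3) * m ^ ((q - 1) / 3) / ((1 / p - 1 / 3) * (q - 1))) := by
  have hq0 : 0 < q := by linarith
  have hs : 0 < (1 / p - 1 / 3) * (q - 1) := by
    have : 1 / 3 < 1 / p := one_div_lt_one_div_of_lt hp hp3
    exact mul_pos (by linarith) (by linarith)
  set B := A * M ^ (2 * (q - 1) / 3) * m ^ ((q - 1) / 3) with hB
  set s := (1 / p - 1 / 3) * (q - 1) with hsdef
  have hB0 : 0 ≤ B := by positivity
  rw [lorentz, if_neg (by simp), ENNReal.toReal_ofReal hq0.le, ← ENNReal.rpow_mul,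
    one_div_mul_cancel hq0.ne', ENNReal.rpow_one]
  have hint : IntegrableOn (fun t : ℝ => B * t ^ (s - 1)) (Ioc 0 1) := by
    have := (intervalIntegral.intervalIntegrable_rpow' (a := 0) (b := 1) (r := s - 1)
      (by linarith)).const_mul B
    rwa [intervalIntegrable_iff_integrableOn_Ioc_of_le zero_le_one] at this
  calc ∫⁻ t in Ioi (0:ℝ), ENNReal.ofReal ((t ^ (1/p) * rearr N u t) ^ q / t)
      ≤ ∫⁻ t in Ioi (0:ℝ), (Ioc (0:ℝ) 1).indicator
          (fun t => ENNReal.ofReal (B * t ^ (s - 1))) t := by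
        refine setLIntegral_mono' measurableSet_Ioi fun t ht => ?_
        have ht0 : 0 < t := ht
        by_cases ht1 : t ≤ 1
        · rw [indicator_of_mem (show t ∈ Ioc (0:ℝ) 1 from ⟨ht0, ht1⟩)]
          refine ENNReal.ofReal_le_ofReal (lorentz_integrand_le hq ht0 (rearr_nonneg N u t) hM hA hm
            (rearr_le_of_eLpNorm_le hu hp hA hup ht0) (rearr_le_of_ae_le hM huM t) ?_)
          simpa using rearr_le_of_eLpNorm_le hu one_pos hm (by simpa using hu1) ht0
        · rw [rearr_eq_zero_of_volume_support_le
            (hsupp.trans (by simpa using (not_le.1 ht1).le))]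
          simp [Real.zero_rpow hq0.ne']
    _ = ∫⁻ t in Ioc (0:ℝ) 1, ENNReal.ofReal (B * t ^ (s - 1)) := by
        rw [lintegral_indicator measurableSet_Ioc, Measure.restrict_restrict measurableSet_Ioc,
          inter_eq_left.2 Ioc_subset_Ioi_self]
    _ = ENNReal.ofReal (∫ t in Ioc (0:ℝ) 1, B * t ^ (s - 1)) := by
        rw [ofReal_integral_eq_lintegral_ofReal hint]
        filter_upwards [ae_restrict_mem measurableSet_Ioc] with t ht
        have := ht.1
        positivity
    _ = ENNReal.ofReal (B / s) := by
        rw [← intervalIntegral.integral_of_le zero_le_one, intervalIntegral.integral_const_mul,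
          integral_rpow (Or.inl (by linarith))]
        simp [Real.zero_rpow hs.ne', div_eq_mul_inv]
    _ ≤ _ := le_rfl

lemma measurableSet_unitCube (N : ℕ) : MeasurableSet (unitCube N) := by
  have : unitCube N = ⋂ i : Fin N, (fun x : Euc N => x i) ⁻¹' Ioo (0:ℝ) 1 := by
    ext; simp [unitCube]
  rw [this]
  exact MeasurableSet.iInter fun i => (by fun_prop : Measurable fun x : Euc N => x i) measurableSet_Ioo

lemma volume_unitCube (N : ℕ) : volume (unitCube N) = 1 := by
  have h := (EuclideanSpace.volume_preserving_symm_measurableEquiv_toLp (Fin N)).symm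
  have e : unitCube N = (MeasurableEquiv.toLp 2 (Fin N → ℝ)).symm ⁻¹'
      (univ.pi fun _ => Ioo (0:ℝ) 1) := by
    ext; simp [unitCube]
  rw [e, (EuclideanSpace.volume_preserving_symm_measurableEquiv_toLp (Fin N)).measure_preimage
    (MeasurableSet.univ_pi fun _ => measurableSet_Ioo).nullMeasurableSet]
  simp [Real.volume_pi_Ioo]

lemma integral_abs_le_of_integral_mul_le {N : ℕ} {g : Euc N → ℝ} {K : ℝ}
    (hg : ContDiff ℝ (⊤ : ℕ∞) g) (hgc : HasCompactSupport g)
    (hK : ∀ h : Euc N → ℝ, ContDiff ℝ (⊤ : ℕ∞) h → HasCompactSupport h → (∀ x, |h x| ≤ 1) →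
      ∫ x, g x * h x ≤ K) :
    ∫ x, |g x| ≤ K := by
  have hpos : ∀ (n : ℕ) x, 0 < (1 / ((n : ℝ) + 1)) ^ 2 + g x ^ 2 := fun n x => by positivity
  set h : ℕ → Euc N → ℝ := fun n x => g x * (√((1 / ((n : ℝ) + 1)) ^ 2 + g x ^ 2))⁻¹ with hh
  have hle : ∀ n x, |h n x| ≤ 1 := by
    intro n x
    rw [hh]
    simp only
    rw [abs_mul, abs_inv, abs_of_nonneg (Real.sqrt_nonneg _),
      mul_inv_le_iff₀ (Real.sqrt_pos.2 (hpos n x)), one_mul]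
    exact Real.abs_le_sqrt (by nlinarith [sq_nonneg (1 / ((n : ℝ) + 1))])
  have hsm : ∀ n, ContDiff ℝ (⊤ : ℕ∞) (h n) := fun n => by
    refine hg.mul (ContDiff.inv (ContDiff.sqrt (by fun_prop) fun x => (hpos n x).ne')
      fun x => (Real.sqrt_pos.2 (hpos n x)).ne')
  have hcs : ∀ n, HasCompactSupport (h n) := fun n => hgc.mul_right
  have hlim : Tendsto (fun n => ∫ x, g x * h n x) atTop (𝓝 (∫ x, |g x|)) := by
    refine tendsto_integral_of_dominated_convergence (fun x => |g x|)
      (fun n => (hg.continuous.mul (hsm n).continuous).aestronglyMeasurable)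
      ((hg.continuous.integrable_of_hasCompactSupport hgc).abs) (fun n => ?_) ?_
    · refine ae_of_all _ fun x => ?_
      rw [Real.norm_eq_abs, abs_mul]
      exact mul_le_of_le_one_right (abs_nonneg _) (hle n x)
    · refine ae_of_all _ fun x => ?_
      by_cases hx : g x = 0
      · simp [hx]
      have h1 : Tendsto (fun n : ℕ => g x * (g x * (√((1 / ((n : ℝ) + 1)) ^ 2 + g x ^ 2))⁻¹)) atTop
          (𝓝 (g x * (g x * (√(0 ^ 2 + g x ^ 2))⁻¹))) := by
        refine (Tendsto.inv₀ (Tendsto.sqrt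
          ((tendsto_one_div_add_atTop_nhds_zero_nat.pow 2).add_const _)) ?_).const_mul _
          |>.const_mul _
        positivity
      convert h1 using 2
      have : |g x| ≠ 0 := by simpa using hx
      rw [zero_pow two_ne_zero, zero_add, Real.sqrt_sq_eq_abs, ← mul_assoc, ← sq, ← sq_abs]
      field_simp
  exact le_of_tendsto' hlim fun n => hK _ (hsm n) (hcs n) (hle n)

lemma integral_fderiv_convolution_mul_le {N : ℕ} {U ρ : Euc N → ℝ} {e : Euc N} {K : ℝ}
    (hU : Integrable U) (hρ : ContDiff ℝ (⊤ : ℕ∞) ρ) (hρc : HasCompactSupport ρ)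
    (hρ0 : ∀ x, 0 ≤ ρ x) (hρ1 : ∫ x, ρ x = 1)
    (hK : ∀ h : Euc N → ℝ, ContDiff ℝ (⊤ : ℕ∞) h → HasCompactSupport h → (∀ x, |h x| ≤ 1) →
      ∫ x, U x * fderiv ℝ h x e ≤ K)
    {h : Euc N → ℝ} (hh : ContDiff ℝ (⊤ : ℕ∞) h) (hhc : HasCompactSupport h)
    (hh1 : ∀ x, |h x| ≤ 1) :
    ∫ x, fderiv ℝ (ρ ⋆[lsmul ℝ ℝ, volume] U) x e * h x ≤ K := by
  have hsm : ContDiff ℝ (⊤ : ℕ∞) (ρ ⋆[lsmul ℝ ℝ, volume] U) :=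
    hρc.contDiff_convolution_left _ hρ hU.locallyIntegrable
  have hρi : Integrable ρ := hρ.continuous.integrable_of_hasCompactSupport hρc
  have hd : Continuous fun x => fderiv ℝ (ρ ⋆[lsmul ℝ ℝ, volume] U) x e :=
    (hsm.continuous_fderiv (by simp)).clm_apply continuous_const
  have hdh : Continuous fun x => fderiv ℝ h x e :=
    (hh.continuous_fderiv (by simp)).clm_apply continuous_const
  have hdhc : HasCompactSupport fun x => fderiv ℝ h x e := hhc.fderiv_apply ℝ e
  obtain ⟨c, hc⟩ := hdh.bounded_above_of_compact_support hdhc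
  have hIBP : ∫ x, fderiv ℝ (ρ ⋆[lsmul ℝ ℝ, volume] U) x e * h x
      = - ∫ x, (ρ ⋆[lsmul ℝ ℝ, volume] U) x * fderiv ℝ h x e := by
    rw [integral_mul_fderiv_eq_neg_fderiv_mul_of_integrable, neg_neg]
    · exact (hd.mul hh.continuous).integrable_of_hasCompactSupport hhc.mul_left
    · exact (hsm.continuous.mul hdh).integrable_of_hasCompactSupport hdhc.mul_left
    · exact (hsm.continuous.mul hh.continuous).integrable_of_hasCompactSupport hhc.mul_left
    · exact fun x _ => hsm.differentiable (by simp) x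
    · exact fun x _ => hh.differentiable (by simp) x
  have hprod : Integrable (fun z : Euc N × Euc N => ρ z.2 * U (z.1 - z.2) * fderiv ℝ h z.1 e)
      (volume.prod volume) := by
    have h1 := hρi.convolution_integrand (lsmul ℝ ℝ) hU
    exact h1.mul_bdd (c := c) (hdh.comp continuous_fst).aestronglyMeasurable
      (ae_of_all _ fun z => hc z.1)
  have hFub : ∫ x, (ρ ⋆[lsmul ℝ ℝ, volume] U) x * fderiv ℝ h x e
      = ∫ y, ρ y * ∫ x, U (x - y) * fderiv ℝ h x e := by
    calc _ = ∫ x, ∫ y, ρ y * U (x - y) * fderiv ℝ h x e := by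
          refine integral_congr_ae (ae_of_all _ fun x => ?_)
          simp only [convolution_def, ContinuousLinearMap.lsmul_apply, smul_eq_mul]
          rw [integral_mul_const]
      _ = ∫ y, ∫ x, ρ y * U (x - y) * fderiv ℝ h x e := integral_integral_swap hprod
      _ = _ := by
          refine integral_congr_ae (ae_of_all _ fun y => ?_)
          simp only [mul_assoc]
          rw [integral_const_mul]
  have hint : Integrable fun y => ρ y * ∫ x, U (x - y) * fderiv ℝ h x e := by
    refine hprod.integral_prod_right.congr (ae_of_all _ fun y => ?_)
    simp only [mul_assoc]
    rw [integral_const_mul]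
  have hshift : ∀ y, -∫ x, U (x - y) * fderiv ℝ h x e ≤ K := by
    intro y
    have h1 := hK (fun x => - h (x + y)) (by fun_prop)
      ((hhc.comp_homeomorph (Homeomorph.addRight y)).comp_left (g := Neg.neg) neg_zero) (fun x => by simpa using hh1 (x + y))
    refine le_trans (le_of_eq ?_) h1
    rw [← integral_add_right_eq_self _ y, ← integral_neg]
    refine integral_congr_ae (ae_of_all _ fun x => ?_)
    simp [fderiv_fun_neg, fderiv_comp_add_right]
  rw [hIBP, hFub, ← integral_neg]
  calc ∫ y, -(ρ y * ∫ x, U (x - y) * fderiv ℝ h x e) ≤ ∫ y, ρ y * K := by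
        refine integral_mono hint.neg (hρi.mul_const K) fun y => ?_
        have := mul_le_mul_of_nonneg_left (hshift y) (hρ0 y)
        simpa using this
    _ = K := by rw [integral_mul_const, hρ1, one_mul]

lemma norm_clm_le_sum_single {N : ℕ} (L : Euc N →L[ℝ] ℝ) :
    ‖L‖ ≤ ∑ i, |L (EuclideanSpace.single i 1)| := by
  refine L.opNorm_le_bound (Finset.sum_nonneg fun i _ => abs_nonneg _) fun x => ?_
  have hx : x = ∑ i, x i • EuclideanSpace.single i (1 : ℝ) := by
    ext j
    simp [Finset.sum_apply, Pi.single_apply]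
  conv_lhs => rw [hx]
  rw [map_sum, Finset.sum_mul]
  refine (norm_sum_le _ _).trans (Finset.sum_le_sum fun i _ => ?_)
  rw [map_smul, norm_smul, mul_comm]
  exact mul_le_mul_of_nonneg_left (PiLp.norm_apply_le x i) (norm_nonneg _)

lemma eLpNorm_le_of_integral_mul_fderiv_le {N : ℕ} (hN : 2 ≤ N) {U : Euc N → ℝ} {K : ℝ}
    (hU : Integrable U) (hUc : HasCompactSupport U)
    (hK : ∀ (i : Fin N) (h : Euc N → ℝ), ContDiff ℝ (⊤ : ℕ∞) h → HasCompactSupport h →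
      (∀ x, |h x| ≤ 1) → ∫ x, U x * fderiv ℝ h x (EuclideanSpace.single i 1) ≤ K) :
    eLpNorm U (ENNReal.ofReal ((N : ℝ) / ((N : ℝ) - 1))) volume ≤
      eLpNormLESNormFDerivOneConst (volume : Measure (Euc N)) ((N : ℝ) / ((N : ℝ) - 1)) *
        ENNReal.ofReal (N * K) := by
  have hN' : (2 : ℝ) ≤ N := by exact_mod_cast hN
  have hp : 0 ≤ (N : ℝ) / ((N : ℝ) - 1) := div_nonneg (by linarith) (by linarith)
  let φ : ℕ → ContDiffBump (0 : Euc N) := fun n =>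
    ⟨1 / ((n : ℝ) + 1), 2 * (1 / ((n : ℝ) + 1)), by positivity, by
      have : 0 < 1 / ((n : ℝ) + 1) := by positivity
      linarith⟩
  have hae : ∀ᵐ x, Tendsto (fun n => ((φ n).normed volume ⋆[lsmul ℝ ℝ, volume] U) x) atTop
      (𝓝 (U x)) := by
    refine ContDiffBump.ae_convolution_tendsto_right_of_locallyIntegrable (K := 2) ?_
      (Eventually.of_forall fun n => le_rfl) hU.locallyIntegrable
    have := (tendsto_one_div_add_atTop_nhds_zero_nat (𝕜 := ℝ)).const_mul 2
    rwa [mul_zero] at this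
  have hsm : ∀ n, ContDiff ℝ (⊤ : ℕ∞) ((φ n).normed volume ⋆[lsmul ℝ ℝ, volume] U) := fun n =>
    (φ n).hasCompactSupport_normed.contDiff_convolution_left _ (φ n).contDiff_normed
      hU.locallyIntegrable
  have hcs : ∀ n, HasCompactSupport ((φ n).normed volume ⋆[lsmul ℝ ℝ, volume] U) := fun n =>
    (φ n).hasCompactSupport_normed.convolution _ hUc
  have hbound : ∀ n, eLpNorm ((φ n).normed volume ⋆[lsmul ℝ ℝ, volume] U)
      (ENNReal.ofReal ((N : ℝ) / ((N : ℝ) - 1))) volume ≤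
      eLpNormLESNormFDerivOneConst (volume : Measure (Euc N)) ((N : ℝ) / ((N : ℝ) - 1)) *
        ENNReal.ofReal (N * K) := by
    intro n
    set V := (φ n).normed volume ⋆[lsmul ℝ ℝ, volume] U with hV
    have hconj : NNReal.HolderConjugate (Module.finrank ℝ (Euc N))
        (Real.toNNReal ((N : ℝ) / ((N : ℝ) - 1))) := by
      rw [finrank_euclideanSpace_fin, ← NNReal.holderConjugate_coe_iff, Real.coe_toNNReal _ hp]
      exact Real.HolderConjugate.conjExponent (by push_cast; linarith)
    have h1 := eLpNorm_le_eLpNorm_fderiv_one volume ((hsm n).of_le (by simp)) (hcs n) hconj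
    rw [Real.coe_toNNReal _ hp] at h1
    refine h1.trans ?_
    gcongr
    have hci : ∀ i : Fin N, Continuous fun x => fderiv ℝ V x (EuclideanSpace.single i 1) :=
      fun i => ((hsm n).continuous_fderiv (by simp)).clm_apply continuous_const
    have hdi : ∀ i : Fin N, Integrable fun x => fderiv ℝ V x (EuclideanSpace.single i 1) :=
      fun i => (hci i).integrable_of_hasCompactSupport ((hcs n).fderiv_apply ℝ _)
    have hdV : Integrable (fderiv ℝ V) :=
      ((hsm n).continuous_fderiv (by simp)).integrable_of_hasCompactSupport ((hcs n).fderiv ℝ)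
    rw [eLpNorm_one_eq_lintegral_enorm, ← ofReal_integral_norm_eq_lintegral_enorm hdV]
    refine ENNReal.ofReal_le_ofReal ?_
    calc ∫ x, ‖fderiv ℝ V x‖
        ≤ ∫ x, ∑ i, |fderiv ℝ V x (EuclideanSpace.single i 1)| :=
          integral_mono hdV.norm (integrable_finsetSum _ fun i _ => (hdi i).abs)
            fun x => norm_clm_le_sum_single _
      _ = ∑ i : Fin N, ∫ x, |fderiv ℝ V x (EuclideanSpace.single i 1)| :=
          integral_finsetSum _ fun i _ => (hdi i).abs
      _ ≤ ∑ i : Fin N, K := by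
          refine Finset.sum_le_sum fun i _ => ?_
          refine integral_abs_le_of_integral_mul_le
            (((hsm n).fderiv_right (m := (⊤ : ℕ∞)) (by simp)).clm_apply contDiff_const)
            ((hcs n).fderiv_apply ℝ _) fun h hh hhc hh1 => ?_
          exact integral_fderiv_convolution_mul_le hU (φ n).contDiff_normed
            (φ n).hasCompactSupport_normed (φ n).nonneg_normed (φ n).integral_normed (hK i)
            hh hhc hh1
      _ = N * K := by simp
  refine (Lp.eLpNorm_lim_le_liminf_eLpNorm
    (fun n => (hsm n).continuous.aestronglyMeasurable) U hae).trans ?_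
  exact liminf_le_of_le (by isBoundedDefault) fun b hb => by
    obtain ⟨n, hn⟩ := hb.exists
    exact hn.trans (hbound n)

lemma deriv_smoothTransition_of_one_lt {x : ℝ} (h1 : 1 < x) :
    deriv Real.smoothTransition x = 0 := by
  have : Real.smoothTransition =ᶠ[𝓝 x] fun _ => 1 := by
    filter_upwards [lt_mem_nhds h1] with y hy
      using Real.smoothTransition.one_of_one_le (le_of_lt hy)
  simpa using this.deriv_eq

lemma exists_bound_deriv_smoothTransition :
    ∃ B : ℝ, 0 ≤ B ∧ ∀ x, |deriv Real.smoothTransition x| ≤ B := by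
  have hc : Continuous (deriv Real.smoothTransition) :=
    (Real.smoothTransition.contDiff (n := 1)).continuous_deriv le_rfl
  obtain ⟨B, hB⟩ := isCompact_Icc.exists_bound_of_continuousOn (s := Icc (0:ℝ) 1) hc.continuousOn
  refine ⟨B, (norm_nonneg _).trans (hB 0 (by simp)), fun x => ?_⟩
  by_cases hx : x ∈ Icc (0:ℝ) 1
  · exact hB x hx
  have hB0 := (norm_nonneg _).trans (hB 0 (by simp))
  have : deriv Real.smoothTransition x = 0 := by
    rcases lt_or_ge x 0 with h0 | h0
    · have : Real.smoothTransition =ᶠ[𝓝 x] fun _ => 0 := by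
        filter_upwards [gt_mem_nhds h0] with y hy
          using Real.smoothTransition.zero_of_nonpos (le_of_lt hy)
      simpa using this.deriv_eq
    · exact deriv_smoothTransition_of_one_lt (not_le.1 fun h => hx ⟨h0, h⟩)
  simpa [this] using hB0

/-- A smooth cutoff on `(0,1)`, vanishing within distance `1/(k+1)` of the endpoints. -/
def intervalCutoff (k : ℕ) (s : ℝ) : ℝ :=
  Real.smoothTransition ((k + 1) * s - 1) * Real.smoothTransition ((k + 1) * (1 - s) - 1)

lemma contDiff_intervalCutoff (k : ℕ) : ContDiff ℝ (⊤ : ℕ∞) (intervalCutoff k) :=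
  (Real.smoothTransition.contDiff.comp (by fun_prop)).mul
    (Real.smoothTransition.contDiff.comp (by fun_prop))

lemma intervalCutoff_nonneg (k : ℕ) (s : ℝ) : 0 ≤ intervalCutoff k s :=
  mul_nonneg (Real.smoothTransition.nonneg _) (Real.smoothTransition.nonneg _)

lemma intervalCutoff_le_one (k : ℕ) (s : ℝ) : intervalCutoff k s ≤ 1 :=
  mul_le_one₀ (Real.smoothTransition.le_one _) (Real.smoothTransition.nonneg _)
    (Real.smoothTransition.le_one _)

lemma mem_Icc_of_intervalCutoff_ne_zero {k : ℕ} {s : ℝ} (h : intervalCutoff k s ≠ 0) :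
    s ∈ Icc (1 / ((k : ℝ) + 1)) (1 - 1 / ((k : ℝ) + 1)) := by
  have hk : (0 : ℝ) < k + 1 := by positivity
  constructor
  · by_contra! hs
    rw [lt_div_iff₀ hk] at hs
    exact h (mul_eq_zero_of_left (Real.smoothTransition.zero_of_nonpos (by linarith)) _)
  · by_contra! hs
    have : 1 - s < 1 / ((k : ℝ) + 1) := by linarith
    rw [lt_div_iff₀ hk] at this
    exact h (mul_eq_zero_of_right _ (Real.smoothTransition.zero_of_nonpos (by linarith)))

lemma deriv_intervalCutoff (k : ℕ) (s : ℝ) : deriv (intervalCutoff k) s =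
    deriv Real.smoothTransition ((k + 1) * s - 1) * (k + 1) *
        Real.smoothTransition ((k + 1) * (1 - s) - 1) -
      Real.smoothTransition ((k + 1) * s - 1) *
        (deriv Real.smoothTransition ((k + 1) * (1 - s) - 1) * (k + 1)) := by
  have hd : Differentiable ℝ Real.smoothTransition :=
    (Real.smoothTransition.contDiff (n := 1)).differentiable one_ne_zero
  have h1 : HasDerivAt (fun s : ℝ => ((k : ℝ) + 1) * s - 1) (k + 1) s := by
    simpa using ((hasDerivAt_id s).const_mul ((k : ℝ) + 1)).sub_const 1
  have h2 : HasDerivAt (fun s : ℝ => ((k : ℝ) + 1) * (1 - s) - 1) (-(k + 1)) s := by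
    simpa using (((hasDerivAt_id s).const_sub 1).const_mul ((k : ℝ) + 1)).sub_const 1
  have h3 := ((hd _).hasDerivAt.comp s h1).mul ((hd _).hasDerivAt.comp s h2)
  refine (h3.deriv : deriv (intervalCutoff k) s = _).trans ?_
  simp only [Function.comp_apply]
  ring

lemma exists_bound_mul_deriv_intervalCutoff : ∃ B : ℝ, 0 ≤ B ∧ ∀ (k : ℕ) (s a L : ℝ),
    0 < s → s < 1 → |a| ≤ L * (s * (1 - s)) → |a * deriv (intervalCutoff k) s| ≤ L * B := by
  obtain ⟨B, hB0, hB⟩ := exists_bound_deriv_smoothTransition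
  refine ⟨4 * B, by positivity, fun k s a L hs0 hs1 ha => ?_⟩
  have hk : (0 : ℝ) < k + 1 := by positivity
  have hL : 0 ≤ L := by
    have h := (abs_nonneg a).trans ha
    exact nonneg_of_mul_nonneg_left h (mul_pos hs0 (by linarith))
  have key : ∀ r b : ℝ, 0 < r → |b| ≤ L * r →
      |b| * (|deriv Real.smoothTransition ((k + 1) * r - 1)| * (k + 1)) ≤ L * (2 * B) := by
    intro r b hr hb
    by_cases h : 1 < ((k : ℝ) + 1) * r - 1
    · rw [deriv_smoothTransition_of_one_lt h]
      simp; positivity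
    · calc |b| * (|deriv Real.smoothTransition ((k + 1) * r - 1)| * (k + 1))
          ≤ L * r * (B * (k + 1)) := by gcongr; exact hB _
        _ = L * (((k + 1) * r) * B) := by ring
        _ ≤ L * (2 * B) := by gcongr; linarith
  have h1 := key s a hs0 (ha.trans (by gcongr; nlinarith))
  have h2 := key (1 - s) a (by linarith) (ha.trans (by gcongr; nlinarith))
  have hψ : ∀ x, |Real.smoothTransition x| ≤ 1 := fun x => by
    rw [abs_of_nonneg (Real.smoothTransition.nonneg x)]; exact Real.smoothTransition.le_one x
  rw [deriv_intervalCutoff, mul_sub]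
  refine (abs_sub _ _).trans ?_
  have e1 : |a * (deriv Real.smoothTransition ((k + 1) * s - 1) * (k + 1) *
        Real.smoothTransition ((k + 1) * (1 - s) - 1))| ≤ L * (2 * B) := by
    rw [← mul_assoc, abs_mul]
    refine (mul_le_of_le_one_right (abs_nonneg _) (hψ _)).trans ?_
    rwa [abs_mul, abs_mul, abs_of_pos hk]
  have e2 : |a * (Real.smoothTransition ((k + 1) * s - 1) *
        (deriv Real.smoothTransition ((k + 1) * (1 - s) - 1) * (k + 1)))| ≤ L * (2 * B) := by
    rw [mul_left_comm, abs_mul]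
    refine (mul_le_of_le_one_left (abs_nonneg _) (hψ _)).trans ?_
    rwa [abs_mul, abs_mul, abs_of_pos hk]
  linarith

lemma eventually_intervalCutoff_eq {s : ℝ} (hs0 : 0 < s) (hs1 : s < 1) :
    ∀ᶠ k : ℕ in atTop, intervalCutoff k s = 1 ∧ deriv (intervalCutoff k) s = 0 := by
  have h : ∀ r : ℝ, 0 < r → ∀ᶠ k : ℕ in atTop, 1 < ((k : ℝ) + 1) * r - 1 := fun r hr => by
    have : Tendsto (fun k : ℕ => ((k : ℝ) + 1) * r) atTop atTop :=
      (tendsto_atTop_add_const_right _ _ tendsto_natCast_atTop_atTop).atTop_mul_const hr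
    filter_upwards [this.eventually_gt_atTop 2] with k hk
    linarith
  filter_upwards [h s hs0, h (1 - s) (by linarith)] with k h1 h2
  refine ⟨?_, ?_⟩
  · rw [intervalCutoff, Real.smoothTransition.one_of_one_le h1.le,
      Real.smoothTransition.one_of_one_le h2.le, one_mul]
  · rw [deriv_intervalCutoff, deriv_smoothTransition_of_one_lt h1,
      deriv_smoothTransition_of_one_lt h2]
    simp

/-- A smooth cutoff on the unit cube, with product structure. -/
def cubeCutoff (N k : ℕ) (x : Euc N) : ℝ := ∏ j : Fin N, intervalCutoff k (x j)

lemma contDiff_cubeCutoff (N k : ℕ) : ContDiff ℝ (⊤ : ℕ∞) (cubeCutoff N k) :=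
  contDiff_prod fun j _ => (contDiff_intervalCutoff k).comp (by fun_prop)

lemma cubeCutoff_nonneg (N k : ℕ) (x : Euc N) : 0 ≤ cubeCutoff N k x :=
  Finset.prod_nonneg fun _ _ => intervalCutoff_nonneg _ _

lemma cubeCutoff_le_one (N k : ℕ) (x : Euc N) : cubeCutoff N k x ≤ 1 :=
  Finset.prod_le_one (fun _ _ => intervalCutoff_nonneg _ _) fun _ _ => intervalCutoff_le_one _ _

lemma fderiv_cubeCutoff (N k : ℕ) (x : Euc N) (i : Fin N) :
    fderiv ℝ (cubeCutoff N k) x (EuclideanSpace.single i 1) =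
      (∏ j ∈ Finset.univ.erase i, intervalCutoff k (x j)) * deriv (intervalCutoff k) (x i) := by
  have hd : Differentiable ℝ (intervalCutoff k) :=
    (contDiff_intervalCutoff k).differentiable (by simp)
  have h : ∀ j ∈ Finset.univ, HasFDerivAt (fun x : Euc N => intervalCutoff k (x j))
      (deriv (intervalCutoff k) (x j) • (EuclideanSpace.proj j : Euc N →L[ℝ] ℝ)) x := fun j _ =>
    (hd _).hasDerivAt.comp_hasFDerivAt x (EuclideanSpace.proj j : Euc N →L[ℝ] ℝ).hasFDerivAt
  have := (HasFDerivAt.finsetProd h).fderiv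
  rw [show cubeCutoff N k = fun x => ∏ j : Fin N, intervalCutoff k (x j) from rfl, this]
  simp

lemma eventually_cubeCutoff_eq {N : ℕ} {x : Euc N} (hx : x ∈ unitCube N) (i : Fin N) :
    ∀ᶠ k : ℕ in atTop, cubeCutoff N k x = 1 ∧
      fderiv ℝ (cubeCutoff N k) x (EuclideanSpace.single i 1) = 0 := by
  have h : ∀ᶠ k : ℕ in atTop, ∀ j : Fin N,
      intervalCutoff k (x j) = 1 ∧ deriv (intervalCutoff k) (x j) = 0 :=
    eventually_all.2 fun j => eventually_intervalCutoff_eq (hx j).1 (hx j).2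
  filter_upwards [h] with k hk
  refine ⟨Finset.prod_eq_one fun j _ => (hk j).1, ?_⟩
  rw [fderiv_cubeCutoff, (hk i).2, mul_zero]

lemma exists_bound_mul_fderiv_cubeCutoff (N : ℕ) : ∃ B : ℝ, 0 ≤ B ∧
    ∀ (k : ℕ) (x : Euc N) (i : Fin N) (a L : ℝ), x ∈ unitCube N →
      |a| ≤ L * (x i * (1 - x i)) →
      |a * fderiv ℝ (cubeCutoff N k) x (EuclideanSpace.single i 1)| ≤ L * B := by
  obtain ⟨B, hB0, hB⟩ := exists_bound_mul_deriv_intervalCutoff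
  refine ⟨B, hB0, fun k x i a L hx ha => ?_⟩
  rw [fderiv_cubeCutoff, mul_left_comm, abs_mul]
  refine (mul_le_of_le_one_left (abs_nonneg _) ?_).trans (hB k _ a L (hx i).1 (hx i).2 ha)
  rw [abs_of_nonneg (Finset.prod_nonneg fun _ _ => intervalCutoff_nonneg _ _)]
  exact Finset.prod_le_one (fun _ _ => intervalCutoff_nonneg _ _)
    fun _ _ => intervalCutoff_le_one _ _

/-- A compact box containing the support of `cubeCutoff N k`. -/
def innerBox (N k : ℕ) : Set (Euc N) :=
  EuclideanSpace.equiv (Fin N) ℝ ⁻¹'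
    univ.pi fun _ => Icc (1 / ((k : ℝ) + 1)) (1 - 1 / ((k : ℝ) + 1))

lemma isCompact_innerBox (N k : ℕ) : IsCompact (innerBox N k) :=
  (EuclideanSpace.equiv (Fin N) ℝ).toHomeomorph.isCompact_preimage.2
    (isCompact_univ_pi fun _ => isCompact_Icc)

lemma innerBox_subset_unitCube (N k : ℕ) : innerBox N k ⊆ unitCube N := by
  intro x hx j
  have h := hx j (mem_univ j)
  have hk : 0 < 1 / ((k : ℝ) + 1) := by positivity
  exact ⟨hk.trans_le h.1, h.2.trans_lt (by linarith)⟩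

lemma support_cubeCutoff_subset (N k : ℕ) : Function.support (cubeCutoff N k) ⊆ innerBox N k :=
  fun _ hx j _ => mem_Icc_of_intervalCutoff_ne_zero
    (Finset.prod_ne_zero_iff.1 hx j (Finset.mem_univ j))

lemma divg_smul_single {N : ℕ} {g : Euc N → ℝ} (hg : Differentiable ℝ g) (i : Fin N)
    (x : Euc N) :
    divg N (fun y => g y • EuclideanSpace.single i (1 : ℝ)) x =
      fderiv ℝ g x (EuclideanSpace.single i 1) := by
  have h : fderiv ℝ (fun y => g y • EuclideanSpace.single i (1 : ℝ)) x =
      (fderiv ℝ g x).smulRight (EuclideanSpace.single i (1 : ℝ)) :=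
    ((hg x).hasFDerivAt.smul_const _).fderiv
  simp [divg, h]

lemma integral_mul_fderiv_mul_cubeCutoff_le {N : ℕ} {u g : Euc N → ℝ}
    (hTV : TV N u (unitCube N) < ∞) (hg : ContDiff ℝ (⊤ : ℕ∞) g)
    (hg2 : ∀ x ∈ unitCube N, |g x| ≤ 2) (i : Fin N) (k : ℕ) :
    ∫ x in unitCube N, u x *
        fderiv ℝ (fun y => g y * cubeCutoff N k y) x (EuclideanSpace.single i 1) ≤
      2 * (TV N u (unitCube N)).toReal := by
  set F : Euc N → ℝ := fun y => g y * cubeCutoff N k y with hF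
  have hFs : ContDiff ℝ (⊤ : ℕ∞) F := hg.mul (contDiff_cubeCutoff N k)
  have hFd : Differentiable ℝ F := hFs.differentiable (by simp)
  set v : Euc N → Euc N := fun y => ((1 / 2 : ℝ) * F y) • EuclideanSpace.single i (1 : ℝ) with hv
  have hvs : ContDiff ℝ (⊤ : ℕ∞) v := (contDiff_const.mul hFs).smul contDiff_const
  have hsuppF : Function.support F ⊆ innerBox N k :=
    (Function.support_mul_subset_right _ _).trans (support_cubeCutoff_subset N k)
  have hsupp : Function.support v ⊆ innerBox N k := by
    refine fun x hx => hsuppF fun h => hx ?_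
    simp [hv, h]
  have hv1 : ∀ x, ‖v x‖ ≤ 1 := by
    intro x
    by_cases hx : x ∈ unitCube N
    · have h1 : |F x| ≤ 2 := by
        rw [hF]
        simp only
        rw [abs_mul, abs_of_nonneg (cubeCutoff_nonneg N k x)]
        exact (mul_le_of_le_one_right (abs_nonneg _) (cubeCutoff_le_one N k x)).trans (hg2 x hx)
      rw [hv]
      simp only [norm_smul, Real.norm_eq_abs, abs_mul, PiLp.norm_single, norm_one]
      rw [abs_of_pos (by norm_num : (0:ℝ) < 1 / 2)]
      linarith
    · have : v x = 0 := by
        by_contra h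
        exact hx (innerBox_subset_unitCube N k (hsupp h))
      simp [this]
  have htsupp : tsupport v ⊆ unitCube N :=
    (closure_minimal hsupp (isCompact_innerBox N k).isClosed).trans (innerBox_subset_unitCube N k)
  have hle : ENNReal.ofReal (∫ x, u x * divg N v x) ≤ TV N u (unitCube N) :=
    le_iSup_of_le v <| le_iSup_of_le hvs <| le_iSup_of_le
      (HasCompactSupport.of_support_subset_isCompact (isCompact_innerBox N k) hsupp) <|
      le_iSup_of_le hv1 <| le_iSup_of_le htsupp le_rfl
  have hle' := (ENNReal.ofReal_le_iff_le_toReal hTV.ne).1 hle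
  have hdiv : ∀ x, divg N v x = 1 / 2 * fderiv ℝ F x (EuclideanSpace.single i 1) := fun x => by
    rw [hv, divg_smul_single (by fun_prop), fderiv_const_mul (hFd x)]
    simp
  have hint : ∫ x, u x * divg N v x =
      1 / 2 * ∫ x in unitCube N, u x * fderiv ℝ F x (EuclideanSpace.single i 1) := by
    rw [setIntegral_eq_integral_of_forall_compl_eq_zero, ← integral_const_mul]
    · refine integral_congr_ae (ae_of_all _ fun x => ?_)
      simp only [hdiv]
      ring
    · intro x hx
      have : fderiv ℝ F x = 0 := by
        by_contra h
        exact hx (innerBox_subset_unitCube N k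
          (closure_minimal hsuppF (isCompact_innerBox N k).isClosed (support_fderiv_subset ℝ h)))
      simp [this]
  rw [hint] at hle'
  linarith

lemma tendsto_integral_mul_fderiv_mul_cubeCutoff {N : ℕ} {u g : Euc N → ℝ} {i : Fin N} {L D : ℝ}
    (hu : IntegrableOn u (unitCube N)) (hg : ContDiff ℝ (⊤ : ℕ∞) g)
    (hgL : ∀ x ∈ unitCube N, |g x| ≤ L * (x i * (1 - x i)))
    (hgD : ∀ x ∈ unitCube N, |fderiv ℝ g x (EuclideanSpace.single i 1)| ≤ D) :
    Tendsto (fun k => ∫ x in unitCube N, u x *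
        fderiv ℝ (fun y => g y * cubeCutoff N k y) x (EuclideanSpace.single i 1)) atTop
      (𝓝 (∫ x in unitCube N, u x * fderiv ℝ g x (EuclideanSpace.single i 1))) := by
  obtain ⟨B, hB0, hB⟩ := exists_bound_mul_fderiv_cubeCutoff N
  have hgd : Differentiable ℝ g := hg.differentiable (by simp)
  have hformula : ∀ k x,
      fderiv ℝ (fun y => g y * cubeCutoff N k y) x (EuclideanSpace.single i 1) =
        g x * fderiv ℝ (cubeCutoff N k) x (EuclideanSpace.single i 1) +
          cubeCutoff N k x * fderiv ℝ g x (EuclideanSpace.single i 1) := fun k x => by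
    rw [fderiv_fun_mul (hgd x) ((contDiff_cubeCutoff N k).differentiable (by simp) x)]
    simp
  have hmeas := measurableSet_unitCube N
  refine tendsto_integral_of_dominated_convergence (fun x => |u x| * (L * B + D))
    (fun k => ?_) (hu.abs.mul_const _) (fun k => ?_) ?_
  · have hs : ContDiff ℝ (⊤ : ℕ∞) fun y => g y * cubeCutoff N k y :=
      hg.mul (contDiff_cubeCutoff N k)
    exact hu.aestronglyMeasurable.mul
      ((hs.continuous_fderiv (by simp)).clm_apply continuous_const).aestronglyMeasurable
  · filter_upwards [ae_restrict_mem hmeas] with x hx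
    rw [Real.norm_eq_abs, abs_mul, hformula]
    gcongr
    refine (abs_add_le _ _).trans (add_le_add (hB k x i _ L hx (hgL x hx)) ?_)
    rw [abs_mul, abs_of_nonneg (cubeCutoff_nonneg N k x)]
    exact (mul_le_of_le_one_left (abs_nonneg _) (cubeCutoff_le_one N k x)).trans (hgD x hx)
  · filter_upwards [ae_restrict_mem hmeas] with x hx
    refine tendsto_const_nhds.congr' ?_
    filter_upwards [eventually_cubeCutoff_eq hx i] with k hk
    rw [hformula, hk.1, hk.2, mul_zero, zero_add, one_mul]

lemma integral_mul_fderiv_le_of_TV {N : ℕ} {u f : Euc N → ℝ}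
    (hu : IntegrableOn u (unitCube N)) (hTV : TV N u (unitCube N) < ∞)
    (hf : ContDiff ℝ (⊤ : ℕ∞) f) (hfc : HasCompactSupport f) (hf1 : ∀ x, |f x| ≤ 1) (i : Fin N) :
    ∫ x in unitCube N, u x * fderiv ℝ f x (EuclideanSpace.single i 1) ≤
      2 * ((TV N u (unitCube N)).toReal + ∫ x in unitCube N, |u x|) := by
  have hmeas := measurableSet_unitCube N
  set e : Euc N := EuclideanSpace.single i 1 with he
  have hei : e i = 1 := by simp [he]
  have hen : ‖e‖ = 1 := by simp [he]
  set a : Euc N → ℝ := fun x => f (x - x i • e) with ha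
  set b : Euc N → ℝ := fun x => f (x + (1 - x i) • e) with hb
  set g : Euc N → ℝ := fun x => f x - (a x * (1 - x i) + b x * x i) with hgdef
  have has : ContDiff ℝ (⊤ : ℕ∞) a := hf.comp (by fun_prop)
  have hbs : ContDiff ℝ (⊤ : ℕ∞) b := hf.comp (by fun_prop)
  have hgs : ContDiff ℝ (⊤ : ℕ∞) g := by fun_prop
  obtain ⟨C, hC⟩ := hf.lipschitzWith_of_hasCompactSupport hfc (by simp)
  have hdf : ∀ x, |fderiv ℝ f x e| ≤ C := fun x => by
    have := (fderiv ℝ f x).le_of_opNorm_le (norm_fderiv_le_of_lipschitz ℝ hC) e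
    simpa [hen] using this
  have hga : ∀ x, HasFDerivAt (fun x : Euc N => x i) (EuclideanSpace.proj i : Euc N →L[ℝ] ℝ) x :=
    fun x => (EuclideanSpace.proj i : Euc N →L[ℝ] ℝ).hasFDerivAt
  have hfd : Differentiable ℝ f := hf.differentiable (by simp)
  have hda : ∀ x, fderiv ℝ a x e = 0 := fun x => by
    have h1 := (hfd (x - x i • e)).hasFDerivAt.comp x
      ((hasFDerivAt_id x).sub ((hga x).smul_const e))
    rw [show a = f ∘ (fun x => x - x i • e) from rfl]
    refine (congrArg (fun T : Euc N →L[ℝ] ℝ => T e) h1.fderiv).trans ?_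
    simp [hei]
  have hdb : ∀ x, fderiv ℝ b x e = 0 := fun x => by
    have h1 := (hfd (x + (1 - x i) • e)).hasFDerivAt.comp x
      ((hasFDerivAt_id x).add (((hga x).const_sub 1).smul_const e))
    rw [show b = f ∘ (fun x => x + (1 - x i) • e) from rfl]
    refine (congrArg (fun T : Euc N →L[ℝ] ℝ => T e) h1.fderiv).trans ?_
    simp [hei]
  have hdg : ∀ x, fderiv ℝ g x e = fderiv ℝ f x e + (a x - b x) := fun x => by
    have had := (has.differentiable (by simp) x).hasFDerivAt
    have hbd := (hbs.differentiable (by simp) x).hasFDerivAt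
    have h1 := (hfd x).hasFDerivAt.sub
      ((had.mul ((hga x).const_sub 1)).add (hbd.mul (hga x)))
    refine (congrArg (fun T : Euc N →L[ℝ] ℝ => T e) h1.fderiv).trans ?_
    simp [hei, hda, hdb]
    ring
  have hab : ∀ x, |a x - b x| ≤ 2 := fun x =>
    (abs_sub _ _).trans (by linarith [hf1 (x - x i • e), hf1 (x + (1 - x i) • e)])
  have hg2 : ∀ x ∈ unitCube N, |g x| ≤ 2 := by
    intro x hx
    obtain ⟨h0, h1⟩ := hx i
    have h2 := abs_le.1 (hf1 x)
    have h3 := abs_le.1 (hf1 (x - x i • e))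
    have h4 := abs_le.1 (hf1 (x + (1 - x i) • e))
    rw [abs_le]
    constructor <;> simp only [hgdef, ha, hb] <;> nlinarith
  have hgL : ∀ x ∈ unitCube N, |g x| ≤ 2 * C * (x i * (1 - x i)) := by
    intro x hx
    obtain ⟨h0, h1⟩ := hx i
    have h2 : |f x - a x| ≤ C * x i := by
      have := hC.dist_le_mul x (x - x i • e)
      rwa [Real.dist_eq, dist_eq_norm, _root_.sub_sub_cancel, norm_smul, hen, mul_one, Real.norm_eq_abs,
        abs_of_pos h0] at this
    have h3 : |f x - b x| ≤ C * (1 - x i) := by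
      have := hC.dist_le_mul x (x + (1 - x i) • e)
      rwa [Real.dist_eq, dist_eq_norm, sub_add_cancel_left, norm_neg, norm_smul, hen, mul_one,
        Real.norm_eq_abs, abs_of_pos (sub_pos.2 h1)] at this
    have h4 : g x = (f x - a x) * (1 - x i) + (f x - b x) * x i := by
      simp only [hgdef]; ring
    rw [h4]
    refine (abs_add_le _ _).trans ?_
    rw [abs_mul, abs_mul, abs_of_pos h0, abs_of_pos (sub_pos.2 h1)]
    nlinarith [mul_le_mul_of_nonneg_right h2 (sub_pos.2 h1).le,
      mul_le_mul_of_nonneg_right h3 h0.le]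
  have hlim := tendsto_integral_mul_fderiv_mul_cubeCutoff (i := i) (L := 2 * C) (D := C + 2)
    hu hgs hgL (fun x _ => by
      rw [← he, hdg]
      exact (abs_add_le _ _).trans (add_le_add (hdf x) (hab x)))
  have hg_le : ∫ x in unitCube N, u x * fderiv ℝ g x e ≤ 2 * (TV N u (unitCube N)).toReal :=
    le_of_tendsto' hlim fun k => integral_mul_fderiv_mul_cubeCutoff_le hTV hgs hg2 i k
  have hint1 : IntegrableOn (fun x => u x * fderiv ℝ g x e) (unitCube N) :=
    Integrable.mul_bdd (c := C + 2) hu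
      ((hgs.continuous_fderiv (by simp)).clm_apply continuous_const).aestronglyMeasurable
      (ae_of_all _ fun x => by
        rw [hdg]
        exact (norm_add_le _ _).trans (add_le_add (hdf x) (hab x)))
  have hint2 : IntegrableOn (fun x => u x * (b x - a x)) (unitCube N) :=
    Integrable.mul_bdd (c := 2) hu (hbs.continuous.sub has.continuous).aestronglyMeasurable
      (ae_of_all _ fun x => by rw [Real.norm_eq_abs, abs_sub_comm]; exact hab x)
  calc ∫ x in unitCube N, u x * fderiv ℝ f x e
      = (∫ x in unitCube N, u x * fderiv ℝ g x e) + ∫ x in unitCube N, u x * (b x - a x) := by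
        rw [← integral_add hint1 hint2]
        refine integral_congr_ae (ae_of_all _ fun x => ?_)
        simp only [hdg]
        ring
    _ ≤ 2 * (TV N u (unitCube N)).toReal + ∫ x in unitCube N, |u x| * 2 := by
        refine add_le_add hg_le (integral_mono hint2 (hu.abs.mul_const 2) fun x => ?_)
        refine (le_abs_self _).trans ?_
        simp only
        rw [abs_mul, abs_sub_comm]
        exact mul_le_mul_of_nonneg_left (hab x) (abs_nonneg _)
    _ = _ := by rw [integral_mul_const]; ring

lemma isBounded_unitCube (N : ℕ) : Bornology.IsBounded (unitCube N) := by
  refine ((EuclideanSpace.equiv (Fin N) ℝ).toHomeomorph.isCompact_preimage.2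
    (isCompact_univ_pi fun _ => isCompact_Icc (a := (0 : ℝ)) (b := 1))).isBounded.subset ?_
  exact fun x hx j _ => Ioo_subset_Icc_self (hx j)

lemma exists_sobolev_unitCube {N : ℕ} (hN : 2 ≤ N) : ∃ C : ℝ, 0 ≤ C ∧ ∀ u : Euc N → ℝ,
    IntegrableOn u (unitCube N) → TV N u (unitCube N) < ∞ →
    eLpNorm ((unitCube N).indicator u) (ENNReal.ofReal ((N : ℝ) / ((N : ℝ) - 1))) volume ≤
      ENNReal.ofReal (C * ((TV N u (unitCube N)).toReal + ∫ x in unitCube N, |u x|)) := by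
  have hmeas := measurableSet_unitCube N
  refine ⟨eLpNormLESNormFDerivOneConst (volume : Measure (Euc N)) ((N : ℝ) / ((N : ℝ) - 1)) *
    (N * 2), by positivity, fun u hu hTV => ?_⟩
  have hm : 0 ≤ ∫ x in unitCube N, |u x| := integral_nonneg fun x => abs_nonneg _
  refine (eLpNorm_le_of_integral_mul_fderiv_le hN
    (K := 2 * ((TV N u (unitCube N)).toReal + ∫ x in unitCube N, |u x|))
    ((integrable_indicator_iff hmeas).2 hu)
    (HasCompactSupport.of_support_subset_isCompact (isBounded_unitCube N).isCompact_closure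
      (support_indicator_subset.trans subset_closure)) fun i h hh hhc hh1 => ?_).trans
    (le_of_eq ?_)
  · refine le_trans (le_of_eq ?_) (integral_mul_fderiv_le_of_TV hu hTV hh hhc hh1 i)
    rw [← integral_indicator hmeas]
    refine integral_congr_ae (ae_of_all _ fun x => ?_)
    by_cases hx : x ∈ unitCube N <;> simp [hx]
  · rw [← ENNReal.ofReal_coe_nnreal, ← ENNReal.ofReal_mul (NNReal.coe_nonneg _)]
    ring_nf

/-- for `u ∈ BV(Ω₀)`, `Ω₀ = (0,1)^N`, with `|u| ≤ M` a.e.,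
`‖u‖_{L^{1*,q}(Ω₀)}^q ≤ C (‖Du‖_{Ω₀} + ‖u‖_{L^1(Ω₀)}) (∫_{Ω₀}|u|)^{(q-1)/3}`. -/
theorem local_lorentz_estimate_cube
    (N : ℕ) (hN : 2 ≤ N) (q : ℝ) (hq1 : 1 < q) (hq2 : q ≤ (N : ℝ) / ((N : ℝ) - 1))
    (M : ℝ) (hM : 0 < M) :
    ∃ C : ℝ, 0 < C ∧ ∀ u : Euc N → ℝ,
      IntegrableOn u (unitCube N) → TV N u (unitCube N) < ∞ →
      (∀ᵐ x ∂(volume.restrict (unitCube N)), |u x| ≤ M) →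
      lorentz N ((N : ℝ) / ((N : ℝ) - 1)) (ENNReal.ofReal q) ((unitCube N).indicator u) ^ q
        ≤ ENNReal.ofReal C * (TV N u (unitCube N) + ENNReal.ofReal (∫ x in unitCube N, |u x|))
          * ENNReal.ofReal ((∫ x in unitCube N, |u x|) ^ ((q - 1) / 3)) := by
  obtain ⟨C, hC, hsob⟩ := exists_sobolev_unitCube hN
  have hN' : (2 : ℝ) ≤ N := by exact_mod_cast hN
  set p : ℝ := (N : ℝ) / ((N : ℝ) - 1) with hp
  have hp0 : 0 < p := div_pos (by linarith) (by linarith)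
  have hp3 : p < 3 := by rw [hp, div_lt_iff₀ (by linarith)]; linarith
  have hs : 0 < (1 / p - 1 / 3) * (q - 1) := by
    have : 1 / 3 < 1 / p := one_div_lt_one_div_of_lt hp0 hp3
    exact mul_pos (by linarith) (by linarith)
  refine ⟨C * M ^ (2 * (q - 1) / 3) / ((1 / p - 1 / 3) * (q - 1)) + 1, by positivity,
    fun u hu hTV huM => ?_⟩
  have hmeas := measurableSet_unitCube N
  have hm : 0 ≤ ∫ x in unitCube N, |u x| := integral_nonneg fun x => abs_nonneg _
  have key := lorentz_rpow_le (u := (unitCube N).indicator u)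
    ((integrable_indicator_iff hmeas).2 hu).aestronglyMeasurable hp0 hp3 hq1 hM.le
    (by positivity : 0 ≤ C * ((TV N u (unitCube N)).toReal + ∫ x in unitCube N, |u x|)) hm
    ((measure_mono support_indicator_subset).trans (volume_unitCube N).le)
    (by
      rw [ae_restrict_iff' hmeas] at huM
      filter_upwards [huM] with x hx
      by_cases h : x ∈ unitCube N
      · simpa [h] using hx h
      · simpa [h] using hM.le)
    (hsob u hu hTV)
    (by
      rw [eLpNorm_indicator_eq_eLpNorm_restrict hmeas, eLpNorm_one_eq_lintegral_enorm]
      exact (ofReal_integral_norm_eq_lintegral_enorm hu).symm.le)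
  refine key.trans ?_
  rw [← ENNReal.ofReal_toReal hTV.ne, ← ENNReal.ofReal_add ENNReal.toReal_nonneg hm,
    ← ENNReal.ofReal_mul (by positivity), ← ENNReal.ofReal_mul (by positivity),
    ENNReal.toReal_ofReal ENNReal.toReal_nonneg]
  refine ENNReal.ofReal_le_ofReal ?_
  have : 0 ≤ ((TV N u (unitCube N)).toReal + ∫ x in unitCube N, |u x|) *
    (∫ x in unitCube N, |u x|) ^ ((q - 1) / 3) := by positivity
  rw [add_mul, add_mul]
  refine (le_of_eq ?_).trans (le_add_of_nonneg_right (by rwa [one_mul]))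
  ring
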